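/- Let λ > 1 and ν > 1 be real, and for μ > 1 set H(μ,v) = (π/2)·(Γ(μ−1)/Γ(μ+2))·( (μ+1)·e^(−(μ−1)v) − (μ−1)·e^(−(μ+1)v) ). Then for every real v: H(λ,v)·H(ν,v) = ( π·(λ+ν−2)·(λ+ν−1) / (2·λ·ν·(λ−1)·(ν−1)) ) · H(λ+ν−1,v) − ( π·(λ+ν+1)·(λ+ν+2) / (2·λ·ν·(λ+1)·(ν+1)) ) · H(λ+ν+1,v). -/

import Mathlib

open Real

/-- The Euclidean AdS₋₁ Klein–Gordon propagator with mass parameter `μ` in the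
hyperbolic-angle variable `v`. -/
noncomputable def Hprop (μ v : ℝ) : ℝ :=
  Real.pi / 2 * (Real.Gamma (μ - 1) / Real.Gamma (μ + 2)) *
    ((μ + 1) * Real.exp (-(μ - 1) * v) - (μ - 1) * Real.exp (-(μ + 1) * v))

/-- Closed form of the propagator, with the Gamma quotient evaluated. -/
theorem Hprop_eq_exp {μ : ℝ} (hμ : 1 < μ) (v : ℝ) :
    Hprop μ v = Real.pi / 2 *
      (Real.exp (-(μ - 1) * v) / (μ * (μ - 1)) - Real.exp (-(μ + 1) * v) / (μ * (μ + 1))) := by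
  have h₀ : μ - 1 ≠ 0 := by linarith
  have h₁ : μ ≠ 0 := by linarith
  have h₂ : μ + 1 ≠ 0 := by linarith
  have hΓ : Real.Gamma (μ - 1) ≠ 0 := (Real.Gamma_pos_of_pos (by linarith)).ne'
  have key : Real.Gamma (μ + 2) = (μ + 1) * (μ * ((μ - 1) * Real.Gamma (μ - 1))) := by
    rw [← Real.Gamma_add_one h₀, sub_add_cancel, ← Real.Gamma_add_one h₁,
      ← Real.Gamma_add_one h₂]
    ring_nf
  rw [Hprop, key]
  field_simp

/-- Two-term Källén–Lehmann expansion of the bubble in dimension `d = −1`. -/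
theorem KL_expansion_AdS_neg_one (lam nu : ℝ) (hlam : 1 < lam) (hnu : 1 < nu) (v : ℝ) :
    Hprop lam v * Hprop nu v =
      Real.pi * (lam + nu - 2) * (lam + nu - 1) /
          (2 * lam * nu * (lam - 1) * (nu - 1)) * Hprop (lam + nu - 1) v -
        Real.pi * (lam + nu + 1) * (lam + nu + 2) /
          (2 * lam * nu * (lam + 1) * (nu + 1)) * Hprop (lam + nu + 1) v := by
  rw [Hprop_eq_exp hlam, Hprop_eq_exp hnu, Hprop_eq_exp (by linarith : 1 < lam + nu - 1),
    Hprop_eq_exp (by linarith : 1 < lam + nu + 1)]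
  have hlow : Real.exp (-(lam + nu - 1 - 1) * v) =
      Real.exp (-(lam - 1) * v) * Real.exp (-(nu - 1) * v) := by
    rw [← Real.exp_add]; ring_nf
  have hshift (x : ℝ) : Real.exp (-(x + 1) * v) =
      Real.exp (-(x - 1) * v) * Real.exp (-2 * v) := by
    rw [← Real.exp_add]; ring_nf
  have hmid : Real.exp (-(lam + nu + 1 - 1) * v) =
      Real.exp (-(lam - 1) * v) * Real.exp (-(nu - 1) * v) * Real.exp (-2 * v) := by
    rw [← Real.exp_add, ← Real.exp_add]; ring_nf
  rw [hshift lam, hshift nu, hshift (lam + nu - 1), hshift (lam + nu + 1), hlow, hmid]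
  generalize Real.exp (-(lam - 1) * v) = x
  generalize Real.exp (-(nu - 1) * v) = y
  generalize Real.exp (-2 * v) = q
  rw [show lam + nu - 1 - 1 = lam + nu - 2 by ring, show lam + nu - 1 + 1 = lam + nu by ring,
    show lam + nu + 1 - 1 = lam + nu by ring, show lam + nu + 1 + 1 = lam + nu + 2 by ring]
  have h₁ : lam ≠ 0 := by linarith
  have h₂ : nu ≠ 0 := by linarith
  have h₃ : lam - 1 ≠ 0 := by linarith
  have h₄ : nu - 1 ≠ 0 := by linarith
  have h₅ : lam + 1 ≠ 0 := by linarith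
  have h₆ : nu + 1 ≠ 0 := by linarith
  have h₇ : lam + nu ≠ 0 := by linarith
  have h₈ : lam + nu - 1 ≠ 0 := by linarith
  have h₉ : lam + nu - 2 ≠ 0 := by linarith
  have h₁₀ : lam + nu + 1 ≠ 0 := by linarith
  have h₁₁ : lam + nu + 2 ≠ 0 := by linarith
  field_simp
  ring
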